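/- arXiv:2602.09073 — 2 statements merged into one kernel-verified Lean document; each statement's English description precedes it below -/
import Mathlib

section
/- Let n ≥ 6 be an even integer. Consider subsets of Dic_{4n} of the form A = R ∪ Sb, where R = {a^r, a^{r+1}, ..., a^{r+n−1}} for some integer 0 ≤ r ≤ n and Sb = {a^{i₁}b, a^{i₂}b, ..., a^{iₙ}b} for some n distinct exponents 0 ≤ i₁, ..., iₙ ≤ 2n−1 (so |A| = 2n). Then: the number of such subsets that are MSTD is at least (n+1)(7·2^{n−3} − 4); the number of such subsets that are MDTS is at least 2(n+1); and the number of such subsets that are balanced is at least (n+1)·Σ_{i=3, i odd}^{n+3} C(2n−i, n−3). -/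
open Finset Pointwise

/-- A finset of a group is MSTD if its sumset `A * A` is larger than its
difference set `A / A = {a₁ * a₂⁻¹}`. -/
def IsMSTD {G : Type*} [Group G] [DecidableEq G] (A : Finset G) : Prop :=
  (A / A).card < (A * A).card

/-- A finset of a group is MDTS if its sumset is smaller than its difference set. -/
def IsMDTS {G : Type*} [Group G] [DecidableEq G] (A : Finset G) : Prop :=
  (A * A).card < (A / A).card

/-- A finset of a group is balanced if its sumset and difference set have equal size. -/
def IsBalanced {G : Type*} [Group G] [DecidableEq G] (A : Finset G) : Prop :=
  (A * A).card = (A / A).card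

/-- Subsets of the form `A = R ∪ Sb` where `R = {a^r, a^(r+1), …, a^(r+n-1)}` for some
`0 ≤ r ≤ n` and `Sb = {a^(i₁) b, …, a^(iₙ) b}` for `n` distinct exponents, i.e. a set
`S ⊆ ℤ/2nℤ` with `|S| = n`. -/
def IsTypeRS (n : ℕ) (A : Finset (QuaternionGroup n)) : Prop :=
  ∃ r : ℕ, r ≤ n ∧ ∃ S : Finset (ZMod (2 * n)), S.card = n ∧
    A = (Finset.range n).image (fun t => QuaternionGroup.a ((r + t : ℕ) : ZMod (2 * n)))
        ∪ S.image QuaternionGroup.xa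

open QuaternionGroup

/-- The element `d` is a difference of two elements of `S`. -/
def HasDifference {G : Type*} [Add G] (S : Finset G) (d : G) : Prop :=
  ∃ x ∈ S, x + d ∈ S

/-- The set `{a^r, …, a^(r+n-1)} ∪ Sb`. -/
def intervalUnion (n r : ℕ) (S : Finset (ZMod (2 * n))) : Finset (QuaternionGroup n) :=
  (Finset.range n).image (fun t => QuaternionGroup.a ((r + t : ℕ) : ZMod (2 * n)))
    ∪ S.image QuaternionGroup.xa

section Membership

variable {n r : ℕ} {S : Finset (ZMod (2 * n))}

lemma a_inv_eq (k : ZMod (2 * n)) : (a k)⁻¹ = a (-k) := rfl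

lemma xa_inv_eq (k : ZMod (2 * n)) : (xa k)⁻¹ = xa ((n : ZMod (2 * n)) + k) := rfl

lemma a_mem_intervalUnion {k : ZMod (2 * n)} :
    a k ∈ intervalUnion n r S ↔ ∃ t < n, (r : ZMod (2 * n)) + t = k := by
  simp [intervalUnion]

lemma xa_mem_intervalUnion {k : ZMod (2 * n)} :
    xa k ∈ intervalUnion n r S ↔ k ∈ S := by
  simp [intervalUnion]

lemma exists_natCast_eq (hn : 0 < n) (k : ZMod (2 * n)) :
    ∃ m < 2 * n, (m : ZMod (2 * n)) = k := by
  have : NeZero (2 * n) := ⟨by omega⟩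
  exact ⟨k.val, k.val_lt, ZMod.natCast_zmod_val k⟩

lemma natCast_inj_of_lt {x y : ℕ} (hx : x < 2 * n) (hy : y < 2 * n)
    (h : (x : ZMod (2 * n)) = y) : x = y := by
  rw [ZMod.natCast_eq_natCast_iff'] at h
  rwa [Nat.mod_eq_of_lt hx, Nat.mod_eq_of_lt hy] at h

lemma natCast_ne_zero_of_lt {x : ℕ} (h0 : 0 < x) (hx : x < 2 * n) :
    (x : ZMod (2 * n)) ≠ 0 := by
  intro h
  have := natCast_inj_of_lt (y := 0) hx (by omega) (by simpa using h)
  omega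

lemma natCast_add_self : (n : ZMod (2 * n)) + n = 0 := by
  have := ZMod.natCast_self (2 * n)
  push_cast at this
  linear_combination this

lemma a_mem_mul (hn : 0 < n) {k : ZMod (2 * n)} (hk : k ≠ 2 * r - 1) :
    a k ∈ intervalUnion n r S * intervalUnion n r S := by
  obtain ⟨m, hm, hmk⟩ := exists_natCast_eq hn (k - 2 * r)
  have hm' : m ≠ 2 * n - 1 := by
    rintro rfl
    apply hk
    have h2 : (2 * n : ZMod (2 * n)) = 0 := by exact_mod_cast ZMod.natCast_self (2 * n)
    rw [Nat.cast_sub (by omega)] at hmk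
    push_cast at hmk
    linear_combination -hmk + h2
  refine Finset.mem_mul.2 ⟨a (r + (min m (n - 1) : ℕ)),
    a_mem_intervalUnion.2 ⟨_, by omega, rfl⟩, a (r + (m - min m (n - 1) : ℕ)),
    a_mem_intervalUnion.2 ⟨_, by omega, rfl⟩, ?_⟩
  rw [a_mul_a, Nat.cast_sub (min_le_left _ _)]
  congr 1
  linear_combination hmk

lemma a_mem_mul_iff :
    (a (2 * r - 1) : QuaternionGroup n) ∈ intervalUnion n r S * intervalUnion n r S ↔
      HasDifference S (2 * r - 1 - n) := by
  have h2 := natCast_add_self (n := n)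
  constructor
  · intro h
    obtain ⟨x, hx, y, hy, hxy⟩ := Finset.mem_mul.1 h
    rcases x with u | s <;> rcases y with v | s'
    · obtain ⟨t, ht, rfl⟩ := a_mem_intervalUnion.1 hx
      obtain ⟨t', ht', rfl⟩ := a_mem_intervalUnion.1 hy
      rw [a_mul_a, a.injEq] at hxy
      refine absurd ?_ (natCast_ne_zero_of_lt (n := n) (x := t + t' + 1) (by omega) (by omega))
      push_cast
      linear_combination hxy
    · simp at hxy
    · simp at hxy
    · rw [xa_mul_xa, a.injEq] at hxy
      refine ⟨s, xa_mem_intervalUnion.1 hx, ?_⟩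
      convert xa_mem_intervalUnion.1 hy using 1
      linear_combination -hxy
  · rintro ⟨s, hs, hs'⟩
    refine Finset.mem_mul.2 ⟨_, xa_mem_intervalUnion.2 hs, _, xa_mem_intervalUnion.2 hs', ?_⟩
    rw [xa_mul_xa]
    congr 1
    ring

lemma card_interval :
    ((Finset.range n).image (fun t : ℕ => (r : ZMod (2 * n)) + t)).card = n := by
  rw [Finset.card_image_of_injOn, Finset.card_range]
  intro x hx y hy h
  simp only [Finset.coe_range, Set.mem_Iio] at hx hy
  exact natCast_inj_of_lt (by omega) (by omega) (add_left_cancel h)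

lemma xa_mem_mul (hn : 0 < n) (he : Even n) (hS : S.card = n) (k : ZMod (2 * n)) :
    xa k ∈ intervalUnion n r S * intervalUnion n r S := by
  have : NeZero (2 * n) := ⟨by omega⟩
  by_contra hcon
  set R := (Finset.range n).image (fun t : ℕ => (r : ZMod (2 * n)) + t) with hR
  have mem_R (x : ZMod (2 * n)) : x ∈ R ↔ ∃ t < n, (r : ZMod (2 * n)) + t = x := by simp [hR]
  have hplus : ∀ s ∈ S, k - s ∉ R := fun s hs h => hcon <| Finset.mem_mul.2
    ⟨_, xa_mem_intervalUnion.2 hs, _, a_mem_intervalUnion.2 ((mem_R _).1 h), by simp⟩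
  have hminus : ∀ s ∈ S, s - k ∉ R := fun s hs h => hcon <| Finset.mem_mul.2
    ⟨_, a_mem_intervalUnion.2 ((mem_R _).1 h), _, xa_mem_intervalUnion.2 hs, by simp⟩
  have hcompl : S.image (fun s => k - s) = Rᶜ := by
    apply Finset.eq_of_subset_of_card_le
    · intro x hx
      obtain ⟨s, hs, rfl⟩ := Finset.mem_image.1 hx
      exact Finset.mem_compl.2 (hplus s hs)
    · rw [Finset.card_image_of_injective _ sub_right_injective, hS, Finset.card_compl,
        card_interval, ZMod.card]
      omega
  have hneg : ∀ x ∈ R, -x ∈ R := by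
    intro x hx
    by_contra h
    rw [← Finset.mem_compl, ← hcompl] at h
    obtain ⟨s, hs, hsx⟩ := Finset.mem_image.1 h
    apply hminus s hs
    convert hx using 1
    linear_combination -hsx
  obtain ⟨t, ht, h1⟩ := (mem_R _).1 (hneg _ ((mem_R _).2 ⟨0, hn, rfl⟩))
  obtain ⟨t', ht', h2⟩ := (mem_R _).1 (hneg _ ((mem_R _).2 ⟨n - 1, by omega, rfl⟩))
  have h3 : t = n - 1 + t' := by
    apply natCast_inj_of_lt (n := n) (by omega) (by omega)
    push_cast at h1 h2 ⊢
    linear_combination h1 - h2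
  have h4 : ((2 * r + (n - 1) : ℕ) : ZMod (2 * n)) = 0 := by
    have : t = n - 1 := by omega
    subst this
    push_cast at h1 ⊢
    linear_combination h1
  rw [ZMod.natCast_eq_zero_iff] at h4
  have := (Dvd.intro n rfl).trans h4
  obtain ⟨m, hm⟩ := he
  omega

lemma a_mem_div (hn : 0 < n) {k : ZMod (2 * n)} (hk : k ≠ n) :
    a k ∈ intervalUnion n r S / intervalUnion n r S := by
  obtain ⟨m, hm, rfl⟩ := exists_natCast_eq hn k
  have hmn : m ≠ n := fun h => hk (by rw [h])
  have h2 := natCast_add_self (n := n)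
  rcases lt_or_ge m n with h | h
  · refine Finset.mem_div.2 ⟨_, a_mem_intervalUnion.2 ⟨m, h, rfl⟩,
      _, a_mem_intervalUnion.2 ⟨0, hn, rfl⟩, ?_⟩
    rw [div_eq_mul_inv, a_inv_eq, a_mul_a]
    simp
  · refine Finset.mem_div.2 ⟨_, a_mem_intervalUnion.2 ⟨0, hn, rfl⟩,
      _, a_mem_intervalUnion.2 ⟨2 * n - m, by omega, rfl⟩, ?_⟩
    rw [div_eq_mul_inv, a_inv_eq, a_mul_a, Nat.cast_sub hm.le]
    congr 1
    push_cast
    linear_combination -h2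

lemma a_mem_div_iff :
    (a n : QuaternionGroup n) ∈ intervalUnion n r S / intervalUnion n r S ↔
      HasDifference S n := by
  have h2 := natCast_add_self (n := n)
  constructor
  · intro h
    obtain ⟨x, hx, y, hy, hxy⟩ := Finset.mem_div.1 h
    rw [div_eq_mul_inv] at hxy
    rcases x with u | s <;> rcases y with v | s'
    · obtain ⟨t, ht, rfl⟩ := a_mem_intervalUnion.1 hx
      obtain ⟨t', ht', rfl⟩ := a_mem_intervalUnion.1 hy
      rw [a_inv_eq, a_mul_a, a.injEq] at hxy
      have := natCast_inj_of_lt (n := n) (x := t) (y := n + t') (by omega) (by omega)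
        (by push_cast; linear_combination hxy)
      omega
    · simp [xa_inv_eq] at hxy
    · simp [a_inv_eq] at hxy
    · rw [xa_inv_eq, xa_mul_xa, a.injEq] at hxy
      refine ⟨s, xa_mem_intervalUnion.1 hx, ?_⟩
      convert xa_mem_intervalUnion.1 hy using 1
      linear_combination -hxy + h2
  · rintro ⟨s, hs, hs'⟩
    refine Finset.mem_div.2 ⟨_, xa_mem_intervalUnion.2 hs, _, xa_mem_intervalUnion.2 hs', ?_⟩
    rw [div_eq_mul_inv, xa_inv_eq, xa_mul_xa]
    congr 1
    linear_combination h2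

lemma xa_mem_div (hn : 0 < n) (hS : S.Nonempty) (k : ZMod (2 * n)) :
    xa k ∈ intervalUnion n r S / intervalUnion n r S := by
  obtain ⟨s, hs⟩ := hS
  have h2 := natCast_add_self (n := n)
  obtain ⟨m, hm, hmk⟩ := exists_natCast_eq hn (s - k - r)
  rcases lt_or_ge m n with h | h
  · refine Finset.mem_div.2 ⟨_, xa_mem_intervalUnion.2 hs,
      _, a_mem_intervalUnion.2 ⟨m, h, rfl⟩, ?_⟩
    rw [div_eq_mul_inv, a_inv_eq, xa_mul_a]
    congr 1
    linear_combination -hmk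
  · refine Finset.mem_div.2 ⟨_, a_mem_intervalUnion.2 ⟨m - n, by omega, rfl⟩,
      _, xa_mem_intervalUnion.2 hs, ?_⟩
    rw [div_eq_mul_inv, xa_inv_eq, a_mul_xa, Nat.cast_sub h]
    congr 1
    linear_combination -hmk + h2

end Membership

lemma card_lt_card_iff_of_almost_univ {G : Type*} [Fintype G] [DecidableEq G]
    {X Y : Finset G} {g h : G} (hX : ∀ x, x ≠ g → x ∈ X) (hY : ∀ x, x ≠ h → x ∈ Y) :
    X.card < Y.card ↔ g ∉ X ∧ h ∈ Y := by
  have key {Z : Finset G} {z : G} (hZ : ∀ x, x ≠ z → x ∈ Z) :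
      Z.card = if z ∈ Z then Fintype.card G else Fintype.card G - 1 := by
    split_ifs with hz
    · rw [← Finset.card_univ]
      congr 1
      ext x
      by_cases hx : x = z <;> simp_all
    · rw [← Finset.card_univ, ← Finset.card_erase_of_mem (Finset.mem_univ z)]
      congr 1
      ext x
      by_cases hx : x = z <;> simp_all
  have : 0 < Fintype.card G := Fintype.card_pos_iff.2 ⟨g⟩
  rw [key hX, key hY]
  split_ifs <;> simp_all

section Classification

variable {n r : ℕ} {S : Finset (ZMod (2 * n))}

lemma mem_mul_of_ne (hn : 0 < n) (he : Even n) (hS : S.card = n) (x : QuaternionGroup n)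
    (hx : x ≠ a (2 * r - 1)) : x ∈ intervalUnion n r S * intervalUnion n r S := by
  rcases x with k | k
  · exact a_mem_mul hn fun h => hx (by rw [h])
  · exact xa_mem_mul hn he hS k

lemma mem_div_of_ne (hn : 0 < n) (hS : S.card = n) (x : QuaternionGroup n)
    (hx : x ≠ a n) : x ∈ intervalUnion n r S / intervalUnion n r S := by
  rcases x with k | k
  · exact a_mem_div hn fun h => hx (by rw [h])
  · exact xa_mem_div hn (Finset.card_pos.1 (by omega)) k

lemma isMSTD_intervalUnion_iff (hn : 0 < n) (he : Even n) (hS : S.card = n) :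
    IsMSTD (intervalUnion n r S) ↔
      ¬ HasDifference S n ∧ HasDifference S (2 * r - 1 - n) := by
  have : NeZero n := ⟨hn.ne'⟩
  rw [IsMSTD, card_lt_card_iff_of_almost_univ (mem_div_of_ne hn hS) (mem_mul_of_ne hn he hS),
    a_mem_mul_iff, a_mem_div_iff]

lemma isMDTS_intervalUnion_iff (hn : 0 < n) (he : Even n) (hS : S.card = n) :
    IsMDTS (intervalUnion n r S) ↔
      ¬ HasDifference S (2 * r - 1 - n) ∧ HasDifference S n := by
  have : NeZero n := ⟨hn.ne'⟩
  rw [IsMDTS, card_lt_card_iff_of_almost_univ (mem_mul_of_ne hn he hS) (mem_div_of_ne hn hS),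
    a_mem_mul_iff, a_mem_div_iff]

lemma isBalanced_intervalUnion (hn : 0 < n) (he : Even n) (hS : S.card = n)
    (h : HasDifference S n) (h' : HasDifference S (2 * r - 1 - n)) :
    IsBalanced (intervalUnion n r S) := by
  apply le_antisymm <;> refine not_lt.1 fun hlt => ?_
  · exact ((isMSTD_intervalUnion_iff hn he hS).1 hlt).1 h
  · exact ((isMDTS_intervalUnion_iff hn he hS).1 hlt).1 h'

lemma add_mem_iff_of_not_hasDifference (hn : 0 < n) (hS : S.card = n) {d : ZMod (2 * n)}
    (hd : ¬ HasDifference S d) (x : ZMod (2 * n)) : x + d ∈ S ↔ x ∉ S := by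
  have : NeZero (2 * n) := ⟨by omega⟩
  refine ⟨fun h hx => hd ⟨x, hx, h⟩, fun hx => ?_⟩
  have hcompl : S.image (fun s => s - d) = Sᶜ := by
    apply Finset.eq_of_subset_of_card_le
    · intro y hy
      obtain ⟨s, hs, rfl⟩ := Finset.mem_image.1 hy
      exact Finset.mem_compl.2 fun h => hd ⟨_, h, by simpa using hs⟩
    · rw [Finset.card_image_of_injective _ sub_left_injective, hS, Finset.card_compl, ZMod.card]
      omega
  rw [← Finset.mem_compl, ← hcompl] at hx
  obtain ⟨s, hs, rfl⟩ := Finset.mem_image.1 hx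
  simpa using hs

lemma add_natCast_mem_iff_of_not_hasDifference (hn : 0 < n) (he : Even n) (hS : S.card = n)
    (hd : ¬ HasDifference S (2 * r - 1 - n)) (x : ZMod (2 * n)) :
    x + n ∈ S ↔ x ∈ S := by
  have hstep := add_mem_iff_of_not_hasDifference hn hS hd
  have heven (j : ℕ) : x + (2 * j : ℕ) * (2 * r - 1 - n) ∈ S ↔ x ∈ S := by
    induction j with
    | zero => simp
    | succ j ih =>
      rw [← ih, ← not_not (a := x + (2 * j : ℕ) * (2 * r - 1 - n : ZMod (2 * n)) ∈ S), ← hstep,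
        ← hstep]
      push_cast
      ring_nf
  obtain ⟨m, hm⟩ := he
  have h2 := natCast_add_self (n := n)
  have hm' : (n : ZMod (2 * n)) = m + m := by exact_mod_cast congrArg Nat.cast hm
  have hx : x + n = x + (2 * m : ℕ) * (2 * r - 1 - n) := by
    push_cast
    linear_combination (2 * r - 1 : ZMod (2 * n)) * hm' + (1 - r + m : ZMod (2 * n)) * h2
  rw [hx, heven m]

lemma hasDifference_or (hn : 0 < n) (he : Even n) (hS : S.card = n) :
    HasDifference S n ∨ HasDifference S (2 * r - 1 - n) := by
  by_contra! h
  obtain ⟨x, hx⟩ := Finset.card_pos.1 (hS.symm ▸ hn)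
  exact h.1 ⟨x, hx, (add_natCast_mem_iff_of_not_hasDifference hn he hS h.2 x).2 hx⟩

end Classification

section Counting

variable {n : ℕ}

lemma intervalUnion_injective {r r' : ℕ} (hn : 0 < n) (hr : r ≤ n) (hr' : r' ≤ n)
    {S S' : Finset (ZMod (2 * n))} (h : intervalUnion n r S = intervalUnion n r' S') :
    r = r' ∧ S = S' := by
  have key {r r' : ℕ} {S S' : Finset (ZMod (2 * n))} (hr' : r' ≤ n)
      (h : intervalUnion n r S = intervalUnion n r' S') : r' ≤ r := by
    by_contra! hlt
    have hmem : a (r : ZMod (2 * n)) ∈ intervalUnion n r S :=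
      a_mem_intervalUnion.2 ⟨0, hn, by simp⟩
    rw [h] at hmem
    obtain ⟨t, ht, htr⟩ := a_mem_intervalUnion.1 hmem
    have := natCast_ne_zero_of_lt (n := n) (x := r' - r + t) (by omega) (by omega)
    rw [Nat.cast_add, Nat.cast_sub hlt.le] at this
    exact this (by linear_combination htr)
  refine ⟨le_antisymm (key hr h.symm) (key hr' h), ?_⟩
  ext k
  rw [← xa_mem_intervalUnion (r := r), h, xa_mem_intervalUnion]

lemma le_ncard_of_forall_le_card (hn : 0 < n) {Q : Finset (QuaternionGroup n) → Prop} {c : ℕ}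
    (T : ℕ → Finset (Finset (ZMod (2 * n)))) (hc : ∀ r ≤ n, c ≤ (T r).card)
    (hT : ∀ r ≤ n, ∀ S ∈ T r, S.card = n ∧ Q (intervalUnion n r S)) :
    (n + 1) * c ≤ {A : Finset (QuaternionGroup n) | IsTypeRS n A ∧ Q A}.ncard := by
  have : NeZero n := ⟨hn.ne'⟩
  let P := (Finset.range (n + 1)).sigma T
  have hP : (n + 1) * c ≤ P.card := by
    rw [Finset.card_sigma]
    calc (n + 1) * c = ∑ _r ∈ Finset.range (n + 1), c := by simp
      _ ≤ _ := Finset.sum_le_sum fun r hr => hc r (by simp at hr; omega)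
  have hinj : Set.InjOn (fun p : Σ _ : ℕ, Finset (ZMod (2 * n)) => intervalUnion n p.1 p.2)
      (P : Set _) := by
    rintro ⟨r, S⟩ hp ⟨r', S'⟩ hp' h
    simp only [P, Finset.mem_coe, Finset.mem_sigma, Finset.mem_range] at hp hp'
    obtain ⟨rfl, rfl⟩ := intervalUnion_injective hn (Nat.le_of_lt_succ hp.1)
      (Nat.le_of_lt_succ hp'.1) h
    rfl
  rw [← Finset.card_image_of_injOn hinj, ← Set.ncard_coe_finset] at hP
  refine hP.trans (Set.ncard_le_ncard ?_ (Set.toFinite _))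
  intro A hA
  obtain ⟨⟨r, S⟩, hp, rfl⟩ := Finset.mem_image.1 (Finset.mem_coe.1 hA)
  simp only [P, Finset.mem_sigma, Finset.mem_range] at hp
  have hr : r ≤ n := by omega
  obtain ⟨hS, hQ⟩ := hT r hr S hp.2
  exact ⟨⟨r, hr, S, hS, rfl⟩, hQ⟩

/-- The set containing `i` for `i ∈ T` and `i + n` for `i < n` outside `T`. -/
def antipodalChoice (n : ℕ) (T : Finset ℕ) : Finset (ZMod (2 * n)) :=
  (Finset.range n).image fun i => ((if i ∈ T then i else i + n : ℕ) : ZMod (2 * n))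

lemma card_antipodalChoice (T : Finset ℕ) : (antipodalChoice n T).card = n := by
  rw [antipodalChoice, Finset.card_image_of_injOn, Finset.card_range]
  intro i hi j hj h
  simp only [Finset.coe_range, Set.mem_Iio] at hi hj
  have := natCast_inj_of_lt (by split_ifs <;> omega) (by split_ifs <;> omega) h
  split_ifs at this <;> omega

lemma not_hasDifference_antipodalChoice (T : Finset ℕ) :
    ¬ HasDifference (antipodalChoice n T) n := by
  rintro ⟨x, hx, hy⟩
  obtain ⟨i, hi, rfl⟩ := Finset.mem_image.1 hx
  obtain ⟨j, hj, h⟩ := Finset.mem_image.1 hy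
  rw [Finset.mem_range] at hi hj
  rw [← Nat.cast_add, ZMod.natCast_eq_natCast_iff'] at h
  have hmod : (i : ℕ) ≡ j [MOD n] := by
    have h' := Nat.ModEq.of_mul_left 2 (show _ ≡ _ [MOD 2 * n] from h)
    split_ifs at h' <;> simpa [Nat.ModEq, eq_comm] using h'
  obtain rfl := Nat.ModEq.eq_of_lt_of_lt hmod hi hj
  split_ifs at h
  · rw [Nat.mod_eq_of_lt (by omega), Nat.mod_eq_of_lt (by omega)] at h
    omega
  · rw [Nat.mod_eq_of_lt (by omega), show i + n + n = i + 2 * n by ring, Nat.add_mod_right,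
      Nat.mod_eq_of_lt (by omega)] at h
    omega

lemma natCast_mem_antipodalChoice {T : Finset ℕ} {i : ℕ} (hi : i < n) :
    (i : ZMod (2 * n)) ∈ antipodalChoice n T ↔ i ∈ T := by
  refine ⟨fun h => ?_, fun h => Finset.mem_image.2 ⟨i, by simpa using hi, by simp [h]⟩⟩
  obtain ⟨j, hj, h⟩ := Finset.mem_image.1 h
  rw [Finset.mem_range] at hj
  have := natCast_inj_of_lt (by split_ifs <;> omega) (by omega) h
  split_ifs at this with hjT
  · exact this ▸ hjT
  · omega

lemma card_image_antipodalChoice :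
    ((Finset.range n).powerset.image (antipodalChoice n)).card = 2 ^ n := by
  rw [Finset.card_image_of_injOn, Finset.card_powerset, Finset.card_range]
  intro T hT T' hT' h
  simp only [Finset.coe_powerset, Set.mem_preimage, Set.mem_powerset_iff,
    Finset.coe_subset] at hT hT'
  ext i
  by_cases hi : i < n
  · rw [← natCast_mem_antipodalChoice hi, h, natCast_mem_antipodalChoice hi]
  · exact ⟨fun h => absurd (Finset.mem_range.1 (hT h)) hi,
      fun h => absurd (Finset.mem_range.1 (hT' h)) hi⟩

lemma card_le_two_pow_of_add_mem_iff (hn : 0 < n) (p : Prop → Prop)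
    (F : Finset (Finset (ZMod (2 * n)))) (hF : ∀ S ∈ F, ∀ x : ZMod (2 * n), x + n ∈ S ↔ p (x ∈ S)) :
    F.card ≤ 2 ^ n := by
  classical
  have hcard : (Finset.range n).powerset.card = 2 ^ n := by simp
  rw [← hcard]
  refine Finset.card_le_card_of_injOn
    (fun S => (Finset.range n).filter fun i => (i : ZMod (2 * n)) ∈ S)
    (fun S _ => Finset.mem_coe.2 (Finset.mem_powerset.2 (Finset.filter_subset _ _))) fun S hS S' hS' h => ?_
  have hlow (i : ℕ) (hi : i < n) : (i : ZMod (2 * n)) ∈ S ↔ (i : ZMod (2 * n)) ∈ S' := by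
    have := Finset.ext_iff.1 h i
    simpa [hi] using this
  ext k
  obtain ⟨m, hm, rfl⟩ := exists_natCast_eq hn k
  rcases lt_or_ge m n with hmn | hmn
  · exact hlow m hmn
  · obtain ⟨i, rfl⟩ := Nat.exists_eq_add_of_le' hmn
    rw [Nat.cast_add, hF S hS, hF S' hS', propext (hlow i (by omega))]

/-- The residues congruent to `e` modulo `2`. -/
def parityClass (n e : ℕ) : Finset (ZMod (2 * n)) :=
  (Finset.range n).image fun i => ((2 * i + e : ℕ) : ZMod (2 * n))

lemma card_parityClass {e : ℕ} (he : e < 2) : (parityClass n e).card = n := by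
  rw [parityClass, Finset.card_image_of_injOn, Finset.card_range]
  intro i hi j hj h
  simp only [Finset.coe_range, Set.mem_Iio] at hi hj
  have := natCast_inj_of_lt (by omega) (by omega) h
  omega

lemma natCast_mem_parityClass (hn : 0 < n) {e m : ℕ} (he : e < 2) :
    (m : ZMod (2 * n)) ∈ parityClass n e ↔ m % 2 = e := by
  constructor
  · intro h
    obtain ⟨i, -, h⟩ := Finset.mem_image.1 h
    have := (Nat.ModEq.of_mul_right n ((ZMod.natCast_eq_natCast_iff _ _ _).1 h) :
      2 * i + e ≡ m [MOD 2])
    unfold Nat.ModEq at this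
    omega
  · intro h
    have hlt := Nat.mod_lt m (show 0 < 2 * n by omega)
    have hpar : m % (2 * n) % 2 = m % 2 := Nat.mod_mod_of_dvd m (Dvd.intro n rfl)
    refine Finset.mem_image.2 ⟨m % (2 * n) / 2, Finset.mem_range.2 (by omega), ?_⟩
    rw [show 2 * (m % (2 * n) / 2) + e = m % (2 * n) by omega, ZMod.natCast_mod]

lemma hasDifference_parityClass (hn : 0 < n) (hne : Even n) {e : ℕ} (he : e < 2) :
    HasDifference (parityClass n e) n := by
  obtain ⟨m, hm⟩ := hne
  refine ⟨(e : ℕ), (natCast_mem_parityClass hn he).2 (by omega), ?_⟩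
  rw [← Nat.cast_add, natCast_mem_parityClass hn he]
  omega

lemma not_hasDifference_parityClass (hn : 0 < n) (hne : Even n) {e : ℕ} (he : e < 2) (r : ℕ) :
    ¬ HasDifference (parityClass n e) (2 * r - 1 - n) := by
  rintro ⟨x, hx, hy⟩
  obtain ⟨m, -, rfl⟩ := exists_natCast_eq hn x
  have h2 := natCast_add_self (n := n)
  have hcast : (m : ZMod (2 * n)) + (2 * r - 1 - n) =
      ((m + 2 * r + (n - 1) : ℕ) : ZMod (2 * n)) := by
    rw [Nat.cast_add, Nat.cast_sub hn]
    push_cast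
    linear_combination -h2
  rw [hcast, natCast_mem_parityClass hn he] at hy
  rw [natCast_mem_parityClass hn he] at hx
  obtain ⟨k, hk⟩ := hne
  omega

lemma parityClass_zero_ne_one (hn : 0 < n) : parityClass n 0 ≠ parityClass n 1 := by
  intro h
  have h0 := (natCast_mem_parityClass (m := 0) hn (show 0 < 2 by omega)).2 rfl
  rw [h, natCast_mem_parityClass hn (by omega)] at h0
  omega

lemma choose_two_mul_le_card_add (hn : 0 < n) (he : Even n) (r : ℕ)
    [DecidablePred fun S : Finset (ZMod (2 * n)) =>
      S.card = n ∧ HasDifference S n ∧ HasDifference S (2 * r - 1 - n)]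
    [Fintype (ZMod (2 * n))] :
    (2 * n).choose n ≤ (Finset.univ.filter fun S : Finset (ZMod (2 * n)) =>
      S.card = n ∧ HasDifference S n ∧ HasDifference S (2 * r - 1 - n)).card
        + 2 ^ n + 2 ^ n := by
  classical
  set B := Finset.univ.filter fun S : Finset (ZMod (2 * n)) =>
    S.card = n ∧ HasDifference S n ∧ HasDifference S (2 * r - 1 - n)
  let F := Finset.univ.filter fun S : Finset (ZMod (2 * n)) =>
    S.card = n ∧ ¬ HasDifference S n
  let F' := Finset.univ.filter fun S : Finset (ZMod (2 * n)) =>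
    S.card = n ∧ ¬ HasDifference S (2 * r - 1 - n)
  have hF : F.card ≤ 2 ^ n := card_le_two_pow_of_add_mem_iff hn Not F fun S hS => by
    obtain ⟨hS, hd⟩ := (Finset.mem_filter.1 hS).2
    exact add_mem_iff_of_not_hasDifference hn hS hd
  have hF' : F'.card ≤ 2 ^ n := card_le_two_pow_of_add_mem_iff hn id F' fun S hS => by
    obtain ⟨hS, hd⟩ := (Finset.mem_filter.1 hS).2
    exact add_natCast_mem_iff_of_not_hasDifference hn he hS hd
  have hsub : Finset.powersetCard n (Finset.univ : Finset (ZMod (2 * n))) ⊆ B ∪ F ∪ F' := by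
    intro S hS
    have := (Finset.mem_powersetCard.1 hS).2
    simp only [B, F, F', Finset.mem_union, Finset.mem_filter, Finset.mem_univ, true_and]
    tauto
  have hle := Finset.card_le_card hsub
  rw [Finset.card_powersetCard, Finset.card_univ, ZMod.card] at hle
  have h1 := Finset.card_union_le (B ∪ F) F'
  have h2 := Finset.card_union_le B F
  omega

end Counting

lemma two_pow_succ_le_centralBinom {m : ℕ} (hm : 3 ≤ m) : 2 ^ (m + 1) ≤ m.centralBinom := by
  induction m, hm using Nat.le_induction with
  | base => decide
  | succ m hm ih =>
    have h := Nat.succ_mul_centralBinom_succ m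
    have : (m + 1) * 2 ^ (m + 1 + 1) ≤ (m + 1) * (m + 1).centralBinom := by
      rw [h, pow_succ]
      nlinarith
    exact Nat.le_of_mul_le_mul_left this (by omega)

lemma sum_choose_add_two_pow_le {n : ℕ} (hn : 4 ≤ n) :
    (∑ i ∈ (Finset.Icc 3 (n + 3)).filter (fun i => Odd i), (2 * n - i).choose (n - 3))
      + 2 ^ n + 2 ^ n ≤ (2 * n).choose n := by
  have hsum : ∑ i ∈ Finset.Icc 3 (n + 3), (2 * n - i).choose (n - 3)
      = (2 * n - 2).choose (n - 2) := by
    have h := Nat.sum_Icc_choose (2 * n - 3) (n - 3)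
    rw [show 2 * n - 3 + 1 = 2 * n - 2 by omega, show n - 3 + 1 = n - 2 by omega] at h
    rw [← h]
    refine Finset.sum_nbij' (fun i => 2 * n - i) (fun i => 2 * n - i) ?_ ?_ ?_ ?_ ?_ <;>
      simp only [Finset.mem_Icc] <;> intros <;> first | trivial | omega
  have hle := Finset.sum_le_sum_of_subset (f := fun i => (2 * n - i).choose (n - 3))
    (Finset.filter_subset (fun i => Odd i) (Finset.Icc 3 (n + 3)))
  rw [hsum] at hle
  obtain ⟨m, rfl⟩ : ∃ m, n = m + 2 := ⟨n - 2, by omega⟩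
  have hcentral := two_pow_succ_le_centralBinom (m := m + 1) (by omega)
  rw [Nat.centralBinom_eq_two_mul_choose, show m + 1 + 1 = m + 2 from rfl] at hcentral
  have hpascal : (2 * (m + 2)).choose (m + 2) =
      (2 * (m + 1)).choose m + 2 * (2 * (m + 1)).choose (m + 1)
        + (2 * (m + 1)).choose (m + 2) := by
    rw [show 2 * (m + 2) = 2 * (m + 1) + 1 + 1 by ring]
    simp only [Nat.choose_succ_succ']
    ring
  rw [show 2 * (m + 2) - 2 = 2 * (m + 1) by omega, show m + 2 - 2 = m by omega] at hle
  omega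

theorem stmt_16 (n : ℕ) (hn : 6 ≤ n) (heven : Even n) :
    (n + 1) * (7 * 2 ^ (n - 3) - 4) ≤
        {A : Finset (QuaternionGroup n) | IsTypeRS n A ∧ IsMSTD A}.ncard ∧
    2 * (n + 1) ≤ {A : Finset (QuaternionGroup n) | IsTypeRS n A ∧ IsMDTS A}.ncard ∧
    (n + 1) * (∑ i ∈ (Finset.Icc 3 (n + 3)).filter (fun i => Odd i),
          (2 * n - i).choose (n - 3)) ≤
        {A : Finset (QuaternionGroup n) | IsTypeRS n A ∧ IsBalanced A}.ncard := by
  classical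
  have hpos : 0 < n := by omega
  have : NeZero (2 * n) := ⟨by omega⟩
  refine ⟨?_, ?_, ?_⟩
  · refine le_ncard_of_forall_le_card hpos
      (fun _ => (Finset.range n).powerset.image (antipodalChoice n)) (fun r _ => ?_) ?_
    · rw [card_image_antipodalChoice]
      have : 2 ^ n = 2 ^ (n - 3) * 2 ^ 3 := by rw [← pow_add]; congr 1; omega
      omega
    · intro r _ S hS
      obtain ⟨T, -, rfl⟩ := Finset.mem_image.1 hS
      have hT := not_hasDifference_antipodalChoice (n := n) T
      have hcard := card_antipodalChoice (n := n) T
      exact ⟨hcard, (isMSTD_intervalUnion_iff hpos heven hcard).2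
        ⟨hT, (hasDifference_or hpos heven hcard).resolve_left hT⟩⟩
  · rw [mul_comm]
    refine le_ncard_of_forall_le_card hpos (fun _ => {parityClass n 0, parityClass n 1})
      (fun r _ => (Finset.card_pair (parityClass_zero_ne_one hpos)).ge) ?_
    intro r _ S hS
    have key (e : ℕ) (he : e < 2) :
        (parityClass n e).card = n ∧ IsMDTS (intervalUnion n r (parityClass n e)) :=
      ⟨card_parityClass he, (isMDTS_intervalUnion_iff hpos heven (card_parityClass he)).2
        ⟨not_hasDifference_parityClass hpos heven he r, hasDifference_parityClass hpos heven he⟩⟩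
    rcases Finset.mem_insert.1 hS with rfl | hS
    · exact key 0 (by omega)
    · rw [Finset.mem_singleton.1 hS]
      exact key 1 (by omega)
  · refine le_ncard_of_forall_le_card hpos
      (fun r => Finset.univ.filter fun S : Finset (ZMod (2 * n)) =>
        S.card = n ∧ HasDifference S n ∧ HasDifference S (2 * r - 1 - n)) (fun r _ => ?_) ?_
    · have h1 := choose_two_mul_le_card_add hpos heven r
      have h2 := sum_choose_add_two_pow_le (n := n) (by omega)
      omega
    · intro r _ S hS
      obtain ⟨hcard, h, h'⟩ := (Finset.mem_filter.1 hS).2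
      exact ⟨hcard, isBalanced_intervalUnion hpos heven hcard h h'⟩
end

section
/- Let n ≥ 6 be an odd integer (so n ≥ 7). Then in the dicyclic group Dic_{4n}: the number of MSTD subsets of cardinality 2n satisfies S_{Dic_{4n}}(2n) ≥ (n+1)(7·2^{n−3} − 4), and the number of balanced subsets of cardinality 2n satisfies B_{Dic_{4n}}(2n) ≥ C(2n, n)·(n+1) − 2^n·(n+1). -/
open Finset Pointwise

open QuaternionGroup in
/-- The subset of the dicyclic group with rotation exponents `R` and reflection exponents `F`. -/
def dicyclicSet (n : ℕ) (R F : Finset (ZMod (2 * n))) : Finset (QuaternionGroup n) :=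
  R.image a ∪ F.image xa

theorem a_mem_dicyclicSet {n : ℕ} {R F : Finset (ZMod (2 * n))} {i : ZMod (2 * n)} :
    QuaternionGroup.a i ∈ dicyclicSet n R F ↔ i ∈ R := by
  simp [dicyclicSet]

theorem xa_mem_dicyclicSet {n : ℕ} {R F : Finset (ZMod (2 * n))} {i : ZMod (2 * n)} :
    QuaternionGroup.xa i ∈ dicyclicSet n R F ↔ i ∈ F := by
  simp [dicyclicSet]

theorem card_dicyclicSet {n : ℕ} (R F : Finset (ZMod (2 * n))) :
    (dicyclicSet n R F).card = R.card + F.card := by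
  rw [dicyclicSet, card_union_of_disjoint, card_image_of_injective, card_image_of_injective]
  · intro i j h
    simpa using h
  · intro i j h
    simpa using h
  · rw [disjoint_left]
    simp

theorem dicyclicSet_injective (n : ℕ) :
    Function.Injective fun p : Finset (ZMod (2 * n)) × Finset (ZMod (2 * n)) =>
      dicyclicSet n p.1 p.2 := by
  rintro ⟨R, F⟩ ⟨R', F'⟩ h
  simp only at h
  refine Prod.ext ?_ ?_ <;> ext i
  · simp only [← a_mem_dicyclicSet (R := R) (F := F), h, a_mem_dicyclicSet]
  · simp only [← xa_mem_dicyclicSet (R := R) (F := F), h, xa_mem_dicyclicSet]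

theorem a_mem_mul_of_add {n : ℕ} {R F : Finset (ZMod (2 * n))} {i j : ZMod (2 * n)}
    (hi : i ∈ R) (hj : j ∈ R) :
    QuaternionGroup.a (i + j) ∈ dicyclicSet n R F * dicyclicSet n R F := by
  rw [← QuaternionGroup.a_mul_a]
  exact mul_mem_mul (a_mem_dicyclicSet.2 hi) (a_mem_dicyclicSet.2 hj)

theorem a_mem_mul_of_sub {n : ℕ} {R F : Finset (ZMod (2 * n))} {i j : ZMod (2 * n)}
    (hi : i ∈ F) (hj : j ∈ F) :
    QuaternionGroup.a ((n : ZMod (2 * n)) + j - i) ∈ dicyclicSet n R F * dicyclicSet n R F := by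
  rw [← QuaternionGroup.xa_mul_xa]
  exact mul_mem_mul (xa_mem_dicyclicSet.2 hi) (xa_mem_dicyclicSet.2 hj)

theorem xa_mem_mul_of_sub {n : ℕ} {R F : Finset (ZMod (2 * n))} {i j : ZMod (2 * n)}
    (hi : i ∈ R) (hj : j ∈ F) :
    QuaternionGroup.xa (j - i) ∈ dicyclicSet n R F * dicyclicSet n R F := by
  rw [← QuaternionGroup.a_mul_xa]
  exact mul_mem_mul (a_mem_dicyclicSet.2 hi) (xa_mem_dicyclicSet.2 hj)

theorem natCast_add_self_zmod (n : ℕ) : (n : ZMod (2 * n)) + n = 0 := by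
  have h := ZMod.natCast_self (2 * n)
  push_cast at h
  rw [← two_mul, h]

theorem xa_div_xa {n : ℕ} (i j : ZMod (2 * n)) :
    QuaternionGroup.xa i / QuaternionGroup.xa j =
      (QuaternionGroup.a (j - i) : QuaternionGroup n) := by
  rw [div_eq_iff_eq_mul, QuaternionGroup.a_mul_xa]
  simp

theorem xa_div_a {n : ℕ} (i j : ZMod (2 * n)) :
    QuaternionGroup.xa i / QuaternionGroup.a j =
      (QuaternionGroup.xa (i - j) : QuaternionGroup n) := by
  rw [div_eq_iff_eq_mul, QuaternionGroup.xa_mul_a]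
  simp

theorem a_div_a {n : ℕ} (i j : ZMod (2 * n)) :
    QuaternionGroup.a i / QuaternionGroup.a j =
      (QuaternionGroup.a (i - j) : QuaternionGroup n) := by
  rw [div_eq_iff_eq_mul, QuaternionGroup.a_mul_a]
  simp

/-- A pair with total size `2 * n` whose difference set `F - R` omits `x` has `F` equal to the
complement of a translate of `R`, so few pairs fail to have full difference set. -/
theorem card_mul_le_ncard_of_sub_full {n : ℕ} [NeZero n] (p : Finset (QuaternionGroup n) → Prop)
    (U V : Finset (Finset (ZMod (2 * n))))
    (hcard : ∀ R ∈ U, ∀ F ∈ V, R.card + F.card = 2 * n)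
    (hp : ∀ R ∈ U, ∀ F ∈ V, (∀ x, ∃ r ∈ R, x + r ∈ F) → p (dicyclicSet n R F)) :
    U.card * (V.card - 2 * n) ≤ {A : Finset (QuaternionGroup n) | A.card = 2 * n ∧ p A}.ncard := by
  set B : Finset (Finset (ZMod (2 * n)) × Finset (ZMod (2 * n))) :=
    (U ×ˢ (univ : Finset (ZMod (2 * n)))).image fun q => (q.1, (q.1.image (q.2 + ·))ᶜ)
  have hBcard : B.card ≤ U.card * (2 * n) := by
    refine card_image_le.trans ?_
    rw [card_product, card_univ, ZMod.card]
  have hsub : ∀ q ∈ (U ×ˢ V) \ B,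
      (dicyclicSet n q.1 q.2).card = 2 * n ∧ p (dicyclicSet n q.1 q.2) := by
    rintro ⟨R, F⟩ h
    rw [mem_sdiff, mem_product] at h
    obtain ⟨⟨hR, hF⟩, hnot⟩ := h
    refine ⟨by rw [card_dicyclicSet]; exact hcard R hR F hF, hp R hR F hF ?_⟩
    by_contra! hx
    obtain ⟨x, hx⟩ := hx
    refine hnot (mem_image.2 ⟨(R, x), by simp [hR], ?_⟩)
    refine Prod.ext rfl (eq_of_subset_of_card_le ?_ ?_).symm
    · intro j hj
      rw [mem_compl, mem_image]
      rintro ⟨r, hr, rfl⟩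
      exact hx r hr hj
    · have h1 := hcard R hR F hF
      rw [card_compl, card_image_of_injective _ (add_right_injective x), ZMod.card]
      dsimp only
      omega
  calc U.card * (V.card - 2 * n) ≤ (U ×ˢ V).card - B.card := by
        rw [card_product, Nat.mul_sub]
        omega
    _ ≤ ((U ×ˢ V) \ B).card := le_card_sdiff _ _
    _ = (((U ×ˢ V) \ B).image fun p => dicyclicSet n p.1 p.2).card :=
        (card_image_of_injective _ (dicyclicSet_injective n)).symm
    _ ≤ _ := by
        rw [← Set.ncard_coe_finset]
        refine Set.ncard_le_ncard (fun A hA => ?_) (Set.toFinite _)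
        obtain ⟨q, hq, rfl⟩ := mem_image.1 (mem_coe.1 hA)
        exact hsub q hq

theorem exists_add_mem_of_card_lt {G : Type*} [AddGroup G] [Fintype G] [DecidableEq G]
    {F : Finset G} (hF : Fintype.card G < 2 * F.card) (x : G) : ∃ j ∈ F, x + j ∈ F := by
  by_contra! h
  have hd : Disjoint (F.image (x + ·)) F := by
    rw [disjoint_left, forall_mem_image]
    exact fun j hj => h j hj
  have h1 := card_le_univ (F.image (x + ·) ∪ F)
  rw [card_union_of_disjoint hd, card_image_of_injective _ (add_right_injective x)] at h1
  omega

theorem isBalanced_dicyclicSet {n : ℕ} [NeZero n] {R F : Finset (ZMod (2 * n))}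
    (hF : n < F.card) (h : ∀ x, ∃ r ∈ R, x + r ∈ F) : IsBalanced (dicyclicSet n R F) := by
  have hF' : Fintype.card (ZMod (2 * n)) < 2 * F.card := by
    rw [ZMod.card]
    omega
  have hmul : dicyclicSet n R F * dicyclicSet n R F = univ := by
    rw [eq_univ_iff_forall]
    rintro (x | x)
    · obtain ⟨j, hj, hj'⟩ := exists_add_mem_of_card_lt hF' (x - n)
      simpa [add_sub_assoc, ← add_assoc] using a_mem_mul_of_sub (R := R) hj hj'
    · obtain ⟨r, hr, hr'⟩ := h x
      simpa using xa_mem_mul_of_sub hr hr'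
  have hdiv : dicyclicSet n R F / dicyclicSet n R F = univ := by
    rw [eq_univ_iff_forall]
    rintro (x | x)
    · obtain ⟨j, hj, hj'⟩ := exists_add_mem_of_card_lt hF' x
      simpa [xa_div_xa] using
        div_mem_div (xa_mem_dicyclicSet (R := R).2 hj) (xa_mem_dicyclicSet (R := R).2 hj')
    · obtain ⟨r, hr, hr'⟩ := h x
      simpa [xa_div_a] using
        div_mem_div (xa_mem_dicyclicSet.2 hr') (a_mem_dicyclicSet.2 hr)
  rw [IsBalanced, hmul, hdiv]

/-- The subsets of `ZMod (2 * n)` containing exactly one of `i` and `i + n` for every `i`. -/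
def antiperiodicSets (n : ℕ) [NeZero n] : Finset (Finset (ZMod (2 * n))) :=
  univ.filter fun S => ∀ i : ZMod (2 * n), i + n ∈ S ↔ i ∉ S

theorem mem_antiperiodicSets {n : ℕ} [NeZero n] {S : Finset (ZMod (2 * n))} :
    S ∈ antiperiodicSets n ↔ ∀ i : ZMod (2 * n), i + n ∈ S ↔ i ∉ S := by
  simp [antiperiodicSets]

theorem card_of_mem_antiperiodicSets {n : ℕ} [NeZero n] {S : Finset (ZMod (2 * n))}
    (hS : S ∈ antiperiodicSets n) : S.card = n := by
  rw [mem_antiperiodicSets] at hS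
  have h : S.image (· + (n : ZMod (2 * n))) = Sᶜ := by
    ext j
    rw [mem_image, mem_compl, ← hS]
    constructor
    · rintro ⟨i, hi, rfl⟩
      rwa [add_assoc, natCast_add_self_zmod, add_zero]
    · intro hj
      exact ⟨_, hj, by rw [add_assoc, natCast_add_self_zmod, add_zero]⟩
  have h1 := congrArg card h
  rw [card_image_of_injective _ (add_left_injective _), card_compl, ZMod.card] at h1
  have h2 := card_le_univ S
  rw [ZMod.card] at h2
  omega

theorem two_pow_le_card_antiperiodicSets (n : ℕ) [NeZero n] :
    2 ^ n ≤ (antiperiodicSets n).card := by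
  have hpos : 0 < n := Nat.pos_of_neZero n
  let f : Finset ℕ → Finset (ZMod (2 * n)) := fun S =>
    univ.filter fun i => if i.val < n then i.val ∈ S else i.val - n ∉ S
  have hval : ∀ m, m < 2 * n → (m : ZMod (2 * n)).val = m := fun m hm => ZMod.val_cast_of_lt hm
  suffices h : (range n).powerset.card ≤ (antiperiodicSets n).card by
    rwa [card_powerset, card_range] at h
  refine card_le_card_of_injOn f ?_ ?_
  · intro S _
    rw [mem_coe, mem_antiperiodicSets]
    intro i
    have hi := ZMod.val_lt i
    have hin : (i + n).val = if i.val < n then i.val + n else i.val - n := by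
      rw [ZMod.val_add, hval n (by omega)]
      split_ifs with h
      · exact Nat.mod_eq_of_lt (by omega)
      · rw [Nat.mod_eq_sub_mod (by omega), Nat.mod_eq_of_lt (by omega)]
        omega
    simp only [f, mem_filter, mem_univ, true_and, hin]
    by_cases h : i.val < n
    · simp [h]
    · have h' : i.val - n < n := by omega
      simp [h, h']
  · intro S hS T hT h
    rw [mem_coe, mem_powerset] at hS hT
    ext m
    by_cases hm : m < n
    · have := Finset.ext_iff.1 h (m : ZMod (2 * n))
      simpa [f, hval m (by omega), hm] using this
    · exact iff_of_false (fun h => hm (mem_range.1 (hS h))) (fun h => hm (mem_range.1 (hT h)))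

theorem isMSTD_dicyclicSet {n : ℕ} [NeZero n] (hodd : Odd n) {R F : Finset (ZMod (2 * n))}
    (hR : R ∈ antiperiodicSets n) (hF : F ∈ antiperiodicSets n)
    (h : ∀ x, ∃ r ∈ R, x + r ∈ F) : IsMSTD (dicyclicSet n R F) := by
  rw [mem_antiperiodicSets] at hR hF
  have hnn := natCast_add_self_zmod n
  obtain ⟨k, hk⟩ := hodd
  have hkn : (n : ZMod (2 * n)) = 2 * k + 1 := by
    exact_mod_cast congrArg (Nat.cast : ℕ → ZMod (2 * n)) hk
  have heven : ∀ s : ZMod (2 * n),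
      QuaternionGroup.a (s + s) ∈ dicyclicSet n R F * dicyclicSet n R F := by
    intro s
    by_cases hs : s ∈ R
    · exact a_mem_mul_of_add hs hs
    · have hs' := (hR s).2 hs
      have h1 := a_mem_mul_of_add (F := F) hs' hs'
      rwa [show s + n + (s + n) = s + s by linear_combination hnn] at h1
  have hsub : ∀ s : ZMod (2 * n), ∃ j ∈ F, j + (s + s) ∈ F := by
    intro s
    by_contra! hs
    have hstep : ∀ m : ℕ, ∀ j ∈ F, j + m * (s + s + n) ∈ F := by
      intro m
      induction m with
      | zero => simp
      | succ m ih =>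
        intro j hj
        have h1 := (hF _).2 (hs _ (ih j hj))
        convert h1 using 1
        push_cast
        ring
    have hmul : (n : ZMod (2 * n)) * (s + s + n) = n := by
      linear_combination (s + k) * hnn + (n : ZMod (2 * n)) * hkn
    have hper : ∀ j ∈ F, j + n ∈ F := by
      intro j hj
      simpa [hmul] using hstep n j hj
    obtain ⟨r, -, hr⟩ := h 0
    exact (hF _).1 (hper _ hr) hr
  have hmul : dicyclicSet n R F * dicyclicSet n R F = univ := by
    rw [eq_univ_iff_forall]
    rintro (x | x)
    · rcases Nat.even_or_odd' x.val with ⟨m, hm | hm⟩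
      · have hx : x = m + m := by
          rw [← ZMod.natCast_zmod_val x, hm]
          push_cast
          ring
        rw [hx]
        exact heven m
      · have hx : x = 2 * m + 1 := by
          rw [← ZMod.natCast_zmod_val x, hm]
          push_cast
          ring
        obtain ⟨j, hj, hj'⟩ := hsub (m - k)
        have h1 := a_mem_mul_of_sub (R := R) hj hj'
        rwa [show (n : ZMod (2 * n)) + (j + (m - k + (m - k))) - j = x by
          linear_combination hkn - hx] at h1
    · obtain ⟨r, hr, hr'⟩ := h x
      simpa using xa_mem_mul_of_sub hr hr'
  have hdiv : QuaternionGroup.a (n : ZMod (2 * n)) ∉ dicyclicSet n R F / dicyclicSet n R F := by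
    rw [mem_div]
    rintro ⟨i | i, hi, j | j, hj, hij⟩
    · rw [a_div_a, QuaternionGroup.a.injEq, sub_eq_iff_eq_add] at hij
      rw [a_mem_dicyclicSet] at hi hj
      rw [hij, add_comm] at hi
      exact (hR _).1 hi hj
    · rw [div_eq_iff_eq_mul, QuaternionGroup.a_mul_xa] at hij
      cases hij
    · rw [xa_div_a] at hij
      cases hij
    · rw [xa_div_xa, QuaternionGroup.a.injEq, sub_eq_iff_eq_add] at hij
      rw [xa_mem_dicyclicSet] at hi hj
      rw [hij, add_comm] at hj
      exact (hF _).1 hj hi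
  rw [IsMSTD, hmul]
  exact card_lt_card (ssubset_univ_iff.2 fun h => hdiv (h ▸ mem_univ _))

theorem three_mul_succ_le_two_pow {n : ℕ} (hn : 6 ≤ n) : 3 * (n + 1) ≤ 2 ^ n := by
  induction n, hn using Nat.le_induction with
  | base => norm_num
  | succ n hn ih =>
    rw [pow_succ]
    omega

theorem choose_two_mul_mul_succ_le {n : ℕ} (hn : 6 ≤ n) :
    (2 * n).choose n * (n + 1) ≤
      (2 * n).choose (n - 1) * ((2 * n).choose (n + 1) - 2 * n) := by
  have hsymm : (2 * n).choose (n - 1) = (2 * n).choose (n + 1) :=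
    Nat.choose_symm_of_eq_add (by omega)
  have hsucc : (2 * n).choose (n + 1) * (n + 1) = (2 * n).choose n * n := by
    rw [Nat.choose_succ_right_eq]
    congr 1
    omega
  have hcentral := Nat.four_pow_lt_mul_centralBinom n (by omega)
  rw [Nat.centralBinom_eq_two_mul_choose] at hcentral
  rw [hsymm]
  set C := (2 * n).choose n
  set D := (2 * n).choose (n + 1)
  have hfour : 4 ^ n = 2 ^ n * 2 ^ n := by
    rw [← mul_pow]
    norm_num
  have hpow := three_mul_succ_le_two_pow hn
  have hpow' := Nat.mul_le_mul hpow hpow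
  have hD : 4 * n + 2 ≤ D := by
    by_contra! hlt
    have h1 : D * (n + 1) ≤ (4 * n + 2) * (n + 1) := Nat.mul_le_mul_right _ hlt.le
    nlinarith
  have hCD : C ≤ 2 * D := by
    nlinarith
  calc C * (n + 1) ≤ 2 * D * (n + 1) := Nat.mul_le_mul_right _ hCD
    _ = D * (2 * (n + 1)) := by ring
    _ ≤ D * (D - 2 * n) := Nat.mul_le_mul_left _ (by omega)

theorem stmt_19 (n : ℕ) (hn : 6 ≤ n) (hodd : Odd n) :
    (n + 1) * (7 * 2 ^ (n - 3) - 4) ≤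
        {A : Finset (QuaternionGroup n) | A.card = 2 * n ∧ IsMSTD A}.ncard ∧
    (2 * n).choose n * (n + 1) - 2 ^ n * (n + 1) ≤
        {A : Finset (QuaternionGroup n) | A.card = 2 * n ∧ IsBalanced A}.ncard := by
  have : NeZero n := ⟨by omega⟩
  constructor
  · refine le_trans ?_ (card_mul_le_ncard_of_sub_full IsMSTD
      (antiperiodicSets n) (antiperiodicSets n) ?_ ?_)
    · have hcard := two_pow_le_card_antiperiodicSets n
      have hpow := three_mul_succ_le_two_pow hn
      have hsplit : 2 ^ n = 8 * 2 ^ (n - 3) := by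
        rw [show (8 : ℕ) = 2 ^ 3 by norm_num, ← pow_add]
        congr 1
        omega
      rw [mul_comm (n + 1)]
      exact Nat.mul_le_mul (by omega) (by omega)
    · intro R hR F hF
      rw [card_of_mem_antiperiodicSets hR, card_of_mem_antiperiodicSets hF, two_mul]
    · intro R hR F hF h
      exact isMSTD_dicyclicSet hodd hR hF h
  · refine le_trans ?_ (card_mul_le_ncard_of_sub_full IsBalanced
      (powersetCard (n - 1) univ) (powersetCard (n + 1) univ) ?_ ?_)
    · rw [card_powersetCard, card_powersetCard, card_univ, ZMod.card]
      exact (Nat.sub_le _ _).trans (choose_two_mul_mul_succ_le hn)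
    · intro R hR F hF
      rw [(mem_powersetCard.1 hR).2, (mem_powersetCard.1 hF).2]
      omega
    · intro R _ F hF h
      exact isBalanced_dicyclicSet (by rw [(mem_powersetCard.1 hF).2]; omega) h
end
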